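/- arXiv:2011.01951 — 2 statements merged into one kernel-verified Lean document; each statement's English description precedes it below -/
import Mathlib

section
/- Let M ≥ 1, let U ∈ U_sym be determined by the function c : G^{N−1} → G, let Φ̃^U : A_alg^{(N)} → A_alg^{(N+M)} be the unique unital embedding associated with U (acting by Φ̃^U(|h;𝟙⟩⟨j;𝟙|) = Σ_{g⃗∈G^M} |(h, c(h)⁻¹g⃗);𝟙⟩⟨(j, c(j)⁻¹g⃗);𝟙| and Φ̃^U(Π_{h;χ≠𝟙}) = Σ_{g⃗∈G^M} Π_{(h,g⃗);χ≠𝟙}), set Φ^U := Φ̃^U ∘ Π_alg^{(N)} : L(H_N) → L(H_{N+M}), and let Trinv^U := (Φ^U)† be its adjoint with respect to the Hilbert–Schmidt inner product. Then: (a) Trinv^U is trace-preserving, i.e. tr(Trinv^U(ρ)) = tr(ρ) for all ρ ∈ L(H_{N+M}); (b) Trinv^U maps A_alg^{(N+M)} onto A_alg^{(N)}; (c) for all h, j ∈ G^{N−1} and ρ ∈ L(H_{N+M}), ⟨h;𝟙| Trinv^U(ρ) |j;𝟙⟩ = Σ_{g⃗∈G^M} ⟨(h, c(h)⁻¹g⃗);𝟙|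 ρ |(j, c(j)⁻¹g⃗);𝟙⟩. -/
noncomputable section

open Matrix

namespace QRF

section Defs

variable (G : Type) [Fintype G] [DecidableEq G] [CommGroup G]

/-- The `K`-particle Hilbert space `ℂ^{G^K}` (as functions `G^K → ℂ`). -/
abbrev Vec (K : ℕ) : Type := (Fin K → G) → ℂ

/-- Linear operators on the `K`-particle Hilbert space. -/
abbrev Op (K : ℕ) : Type := Matrix (Fin K → G) (Fin K → G) ℂ

variable {G}

/-- The standard basis vector `|x⟩`. -/
def ket {K : ℕ} (x : Fin K → G) : Vec G K := fun y => if y = x then 1 else 0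

/-- The global translation `T_g`, `T_g |x₁,…,x_K⟩ = |g x₁, …, g x_K⟩`. -/
def trans {K : ℕ} (g : G) : Op G K :=
  Matrix.of fun x y => if x = (fun i => g * y i) then 1 else 0

/-- The configuration `(g, h₁ g, …, h_k g)`, i.e. `|g, hg⟩`. -/
def cfg {k : ℕ} (h : Fin k → G) (g : G) : Fin (k + 1) → G :=
  Fin.cons g fun i => h i * g

/-- The inner product `⟨v, w⟩` (antilinear in the first argument). -/
def inn {K : ℕ} (v w : Vec G K) : ℂ := star v ⬝ᵥ w

/-- The rank-one operator `|v⟩⟨w|`. -/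
def outer {K : ℕ} (v w : Vec G K) : Op G K :=
  Matrix.of fun x y => v x * (starRingEnd ℂ) (w y)

/-- The matrix element `⟨v|A|w⟩`. -/
def melem {K : ℕ} (v : Vec G K) (A : Op G K) (w : Vec G K) : ℂ :=
  star v ⬝ᵥ A.mulVec w

/-- The Hilbert–Schmidt inner product `⟨A,B⟩ := tr(A† B)`. -/
def hsInner {K : ℕ} (A B : Op G K) : ℂ := (Aᴴ * B).trace

variable (G)

/-- The symmetry group `U_sym` of relation-conditional global translations
(for `k+1` particles). -/
def Usym (k : ℕ) : Set (Op G (k + 1)) :=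
  {U | U ∈ Matrix.unitaryGroup (Fin (k + 1) → G) ℂ ∧
    ∃ c : (Fin k → G) → G, ∀ (h : Fin k → G) (g : G),
      U.mulVec (ket (cfg h g)) = (trans (c h)).mulVec (ket (cfg h g))}

/-- The characters of `G`: monoid homomorphisms `G → ℂ` of modulus one. -/
def Ghat : Type := {χ : G →* ℂ // ∀ g : G, ‖χ g‖ = 1}

/-- The trivial character `𝟙`. -/
instance : One (Ghat G) := ⟨⟨1, fun g => by simp⟩⟩

variable {G}

/-- The vector `|h;χ⟩ := |G|^{-1/2} ∑_{g ∈ G} χ(g⁻¹) |g, hg⟩`. -/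
def relKet {k : ℕ} (h : Fin k → G) (χ : Ghat G) : Vec G (k + 1) :=
  ((Real.sqrt (Fintype.card G) : ℂ))⁻¹ • ∑ g : G, χ.1 g⁻¹ • ket (cfg h g)

variable (G)

/-- The relational subspace `H_phys = span{|h;𝟙⟩}`. -/
def Hphys (k : ℕ) : Submodule ℂ (Vec G (k + 1)) :=
  Submodule.span ℂ {v | ∃ h : Fin k → G, v = relKet h (1 : Ghat G)}

/-- `Π_phys = ∑_h |h;𝟙⟩⟨h;𝟙|`, the orthogonal projection onto `H_phys`. -/
def Piphys (k : ℕ) : Op G (k + 1) :=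
  ∑ h : Fin k → G, outer (relKet h (1 : Ghat G)) (relKet h (1 : Ghat G))

variable {G}

/-- `Π_{h;χ≠𝟙} = ∑_{χ ∈ Ĝ, χ ≠ 𝟙} |h;χ⟩⟨h;χ|`. -/
def PiNot1 {k : ℕ} (h : Fin k → G) : Op G (k + 1) :=
  ∑ᶠ (χ : Ghat G) (_ : χ ≠ 1), outer (relKet h χ) (relKet h χ)

variable (G)

/-- The invariant algebra `A_inv`. -/
def Ainv (k : ℕ) : Set (Op G (k + 1)) :=
  {A | ∀ U ∈ Usym G k, U * A * Uᴴ = A}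

/-- The incoherent group average (twirl) `Π_inv` over `U_sym`. -/
def Piinv (k : ℕ) (ρ : Op G (k + 1)) : Op G (k + 1) :=
  (Nat.card ↥(Usym G k) : ℂ)⁻¹ • ∑ᶠ U ∈ Usym G k, U * ρ * Uᴴ

/-- The algebra `A_phys` of relational observables (operators supported on `H_phys`). -/
def Aphys (k : ℕ) : Set (Op G (k + 1)) :=
  {A | A = Piphys G k * A * Piphys G k}

/-- The algebra `A_alg`. -/
def Aalg (k : ℕ) : Set (Op G (k + 1)) :=
  {X | ∃ B ∈ Aphys G k, ∃ a : (Fin k → G) → ℂ,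
      X = B + ∑ h : Fin k → G, a h • PiNot1 h}

variable {G}

/-- The vector `|e⟩_i ⊗ φ`. -/
def insVec {k : ℕ} (i : Fin (k + 1)) (φ : (Fin k → G) → ℂ) : Vec G (k + 1) :=
  fun x => if x i = 1 then φ (fun j => x (i.succAbove j)) else 0

/-- The operator `|e⟩⟨e|_i ⊗ A`. -/
def eAop {k : ℕ} (i : Fin (k + 1)) (A : Matrix (Fin k → G) (Fin k → G) ℂ) :
    Op G (k + 1) :=
  Matrix.of fun x y =>
    if x i = 1 ∧ y i = 1 then
      A (fun j => x (i.succAbove j)) (fun j => y (i.succAbove j))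
    else 0

/-- `ψ` is `i`-alignable. -/
def IAlignable {k : ℕ} (i : Fin (k + 1)) (ψ : Vec G (k + 1)) : Prop :=
  ∃ (θ : ℝ) (U : Op G (k + 1)) (φ : (Fin k → G) → ℂ),
    U ∈ Usym G k ∧ ψ = Complex.exp (θ * Complex.I) • U.mulVec (insVec i φ)

/-- `ψ` is alignable. -/
def Alignable {k : ℕ} (ψ : Vec G (k + 1)) : Prop := ∃ i, IAlignable i ψ

/-- Symmetry equivalence of state vectors (up to a global phase). -/
def SymmEquiv {k : ℕ} (ψ ψ' : Vec G (k + 1)) : Prop :=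
  ∃ (θ : ℝ) (U : Op G (k + 1)),
    U ∈ Usym G k ∧ ψ' = Complex.exp (θ * Complex.I) • U.mulVec ψ

/-- `P` is the orthogonal projection of operator space onto the set `S`,
with respect to the Hilbert–Schmidt inner product. -/
def IsHSProj {K : ℕ} (S : Set (Op G K)) (P : Op G K →ₗ[ℂ] Op G K) : Prop :=
  (∀ ρ, P ρ ∈ S) ∧ (∀ A ∈ S, P A = A) ∧
    ∀ ρ σ, hsInner (P ρ) σ = hsInner ρ (P σ)

/-- First `n+1` components of an `(n+1)+(m+1)`-particle configuration. -/
def split1 {n m : ℕ} (x : Fin (n + m + 1 + 1) → G) : Fin (n + 1) → G :=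
  fun i => x ⟨i.1, by have := i.2; omega⟩

/-- Last `m+1` components of an `(n+1)+(m+1)`-particle configuration. -/
def split2 {n m : ℕ} (x : Fin (n + m + 1 + 1) → G) : Fin (m + 1) → G :=
  fun i => x ⟨n + 1 + i.1, by have := i.2; omega⟩

/-- The tensor product `A ⊗ B` of operators, under the identification
`H_{N+M} ≅ H_N ⊗ H_M`, `|x,y⟩ ↦ |x⟩ ⊗ |y⟩`. -/
def tensorOp {n m : ℕ} (A : Op G (n + 1)) (B : Op G (m + 1)) :
    Op G (n + m + 1 + 1) :=
  Matrix.of fun x y => A (split1 x) (split1 y) * B (split2 x) (split2 y)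

/-- Concatenation `(h, g⃗)` of relation tuples. -/
def relcat {n m : ℕ} (h : Fin n → G) (gv : Fin (m + 1) → G) :
    Fin (n + m + 1) → G :=
  (Fin.append h gv : Fin (n + (m + 1)) → G)

/-- Joining of configurations `(x, z)`. -/
def join {n m : ℕ} (x : Fin (n + 1) → G) (z : Fin (m + 1) → G) :
    Fin (n + m + 1 + 1) → G :=
  fun i => if hi : i.1 < n + 1 then x ⟨i.1, hi⟩
           else z ⟨i.1 - (n + 1), by have := i.2; omega⟩

/-- The standard partial trace over the last `m+1` particles. -/
def ptraceM {n m : ℕ} (ρ : Op G (n + m + 1 + 1)) : Op G (n + 1) :=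
  Matrix.of fun x y => ∑ z : Fin (m + 1) → G, ρ (join x z) (join y z)

end Defs

section Helpers

variable {G : Type}

section HilbertSchmidt

lemma outer_eq_vecMulVec {K : ℕ} (v w : Vec G K) : outer v w = vecMulVec v (star w) := rfl

variable [Fintype G]

lemma hsInner_add_left {K : ℕ} (A B C : Op G K) :
    hsInner (A + B) C = hsInner A C + hsInner B C := by
  simp [hsInner, add_mul]

lemma hsInner_add_right {K : ℕ} (A B C : Op G K) :
    hsInner A (B + C) = hsInner A B + hsInner A C := by
  simp [hsInner, mul_add]

lemma hsInner_smul_left {K : ℕ} (a : ℂ) (A B : Op G K) :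
    hsInner (a • A) B = star a * hsInner A B := by
  simp [hsInner]

lemma hsInner_smul_right {K : ℕ} (a : ℂ) (A B : Op G K) :
    hsInner A (a • B) = a * hsInner A B := by
  simp [hsInner]

lemma hsInner_sum_left {K : ℕ} {ι : Type*} (s : Finset ι) (A : ι → Op G K) (B : Op G K) :
    hsInner (∑ i ∈ s, A i) B = ∑ i ∈ s, hsInner (A i) B := by
  simp [hsInner, Matrix.conjTranspose_sum, Finset.sum_mul, Matrix.trace_sum]

lemma hsInner_sum_right {K : ℕ} {ι : Type*} (s : Finset ι) (A : Op G K) (B : ι → Op G K) :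
    hsInner A (∑ i ∈ s, B i) = ∑ i ∈ s, hsInner A (B i) := by
  simp [hsInner, Finset.mul_sum, Matrix.trace_sum]

open scoped ComplexOrder in
/-- The Hilbert–Schmidt inner product is nondegenerate. -/
lemma eq_of_hsInner_eq {K : ℕ} {X Y : Op G K} (h : ∀ A, hsInner A X = hsInner A Y) :
    X = Y := by
  rw [← sub_eq_zero, ← Matrix.trace_conjTranspose_mul_self_eq_zero_iff, Matrix.mul_sub,
    Matrix.trace_sub, sub_eq_zero]
  exact h (X - Y)

lemma hsInner_outer_left {K : ℕ} (v w : Vec G K) (A : Op G K) :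
    hsInner (outer v w) A = melem v A w := by
  rw [hsInner, outer_eq_vecMulVec, conjTranspose_vecMulVec, star_star, vecMulVec_mul,
    trace_vecMulVec, dotProduct_comm, ← dotProduct_mulVec, melem]

lemma outer_mul_outer {K : ℕ} (v w x y : Vec G K) :
    outer v w * outer x y = inn w x • outer v y := by
  simp only [outer_eq_vecMulVec, vecMulVec_mul_vecMulVec, vecMulVec_smul, inn]

lemma outer_mul_mul_outer {K : ℕ} (v w x y : Vec G K) (A : Op G K) :
    outer v w * A * outer x y = melem w A x • outer v y := by
  simp only [outer_eq_vecMulVec, vecMulVec_mul, vecMul_vecMulVec, vecMulVec_smul, melem,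
    dotProduct_mulVec]

lemma hsInner_outer_outer {K : ℕ} (v w x y : Vec G K) :
    hsInner (outer v w) (outer x y) = inn v x * inn y w := by
  rw [hsInner_outer_left]
  simp only [melem, outer_eq_vecMulVec, vecMulVec_mulVec, inn,
    dotProduct_smul, MulOpposite.smul_eq_mul_unop, MulOpposite.unop_op]

lemma inn_ket_ket [DecidableEq G] {K : ℕ} (x y : Fin K → G) :
    inn (ket x) (ket y) = if x = y then 1 else 0 := by
  simp [inn, ket, dotProduct, eq_comm]

/-- If a linear map rescales the Hilbert–Schmidt inner product on a set, it does so on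
the span of that set. -/
lemma hsInner_map_map_of_mem_span {K L : ℕ} (Φ : Op G K →ₗ[ℂ] Op G L) (S : Set (Op G K))
    (r : ℂ) (hS : ∀ A ∈ S, ∀ X ∈ S, hsInner (Φ A) (Φ X) = r * hsInner A X)
    {A X : Op G K} (hA : A ∈ Submodule.span ℂ S) (hX : X ∈ Submodule.span ℂ S) :
    hsInner (Φ A) (Φ X) = r * hsInner A X := by
  induction hA, hX using Submodule.span_induction₂ with
  | mem_mem A X hA hX => exact hS A hA X hX
  | zero_left X _ => simp [hsInner]
  | zero_right A _ => simp [hsInner]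
  | add_left A B X _ _ _ h1 h2 => rw [map_add, hsInner_add_left, hsInner_add_left, h1, h2, mul_add]
  | add_right A X Y _ _ _ h1 h2 =>
    rw [map_add, hsInner_add_right, hsInner_add_right, h1, h2, mul_add]
  | smul_left a A X _ _ h1 => rw [map_smul, hsInner_smul_left, hsInner_smul_left, h1, mul_left_comm]
  | smul_right a A X _ _ h1 =>
    rw [map_smul, hsInner_smul_right, hsInner_smul_right, h1, mul_left_comm]

end HilbertSchmidt

lemma relcat_inj {n m : ℕ} {h j : Fin n → G} {x y : Fin (m + 1) → G} :
    relcat h x = relcat j y ↔ h = j ∧ x = y := by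
  constructor
  · intro H
    have Happ : (Fin.append h x : Fin (n + (m + 1)) → G) = Fin.append j y := H
    constructor
    · ext i
      simpa using congrFun Happ (Fin.castAdd (m + 1) i)
    · ext i
      simpa using congrFun Happ (Fin.natAdd n i)
  · rintro ⟨rfl, rfl⟩
    rfl

section Characters

variable [CommGroup G]

lemma cfg_inj {k : ℕ} {h j : Fin k → G} {g g' : G} :
    cfg h g = cfg j g' ↔ h = j ∧ g = g' := by
  unfold cfg
  rw [Fin.cons_inj]
  constructor
  · rintro ⟨rfl, h2⟩
    exact ⟨funext fun i => mul_right_cancel (congrFun h2 i), rfl⟩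
  · rintro ⟨rfl, rfl⟩
    exact ⟨rfl, rfl⟩

lemma relcat_mul_inj {n m : ℕ} {h j : Fin n → G} {c : (Fin n → G) → G}
    {x y : Fin (m + 1) → G} :
    relcat h (fun t => (c h)⁻¹ * x t) = relcat j (fun t => (c j)⁻¹ * y t) ↔ h = j ∧ x = y := by
  rw [relcat_inj]
  constructor
  · rintro ⟨rfl, H⟩
    exact ⟨rfl, funext fun t => mul_left_cancel (congrFun H t)⟩
  · rintro ⟨rfl, rfl⟩
    exact ⟨rfl, rfl⟩

lemma star_apply_inv (χ : Ghat G) (g : G) : star (χ.1 g⁻¹) = χ.1 g := by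
  have h1 : χ.1 g * χ.1 g⁻¹ = 1 := by rw [← map_mul]; simp
  have h2 : star (χ.1 g⁻¹) * χ.1 g⁻¹ = 1 := by
    have := Complex.conj_mul' (χ.1 g⁻¹)
    rw [χ.2] at this
    simpa using this
  exact mul_right_cancel₀ (right_ne_zero_of_mul_eq_one h1) (h2.trans h1.symm)

variable [Fintype G]

instance : Finite (Ghat G) := by
  have : Finite (G →* ℂ) := (linearIndependent_monoidHom G ℂ).finite_of_isNoetherian
  exact Finite.of_injective (fun χ : Ghat G => χ.1) Subtype.val_injective

open Classical in
lemma sum_char_mul_char_inv (χ ψ : Ghat G) :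
    ∑ g : G, χ.1 g * ψ.1 g⁻¹ = if χ = ψ then (Fintype.card G : ℂ) else 0 := by
  have hinv : ∀ (φ : Ghat G) (g : G), φ.1 g * φ.1 g⁻¹ = 1 := fun φ g => by
    rw [← map_mul]; simp
  split_ifs with h
  · subst h
    simp only [hinv, Finset.sum_const, Finset.card_univ, nsmul_eq_mul, mul_one]
  · refine sum_hom_units_eq_zero (χ.1 * ψ.1.comp invMonoidHom) fun H => h ?_
    refine Subtype.ext (MonoidHom.ext fun g => ?_)
    have h1 : χ.1 g * ψ.1 g⁻¹ = 1 := DFunLike.congr_fun H g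
    exact mul_right_cancel₀ (right_ne_zero_of_mul_eq_one h1) (h1.trans (hinv ψ g).symm)

variable (G) in
/-- The finite set of nontrivial characters of `G`. -/
def nontrivialChars : Finset (Ghat G) := (Set.toFinite {χ : Ghat G | χ ≠ 1}).toFinset

lemma one_notMem_nontrivialChars : (1 : Ghat G) ∉ nontrivialChars G := by
  simp [nontrivialChars]

variable [DecidableEq G]

open Classical in
/-- The vectors `|h;χ⟩` are orthonormal. -/
lemma inn_relKet_relKet {k : ℕ} (h j : Fin k → G) (χ ψ : Ghat G) :
    inn (relKet h χ) (relKet j ψ) = if h = j ∧ χ = ψ then 1 else 0 := by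
  have hsq : ((Real.sqrt (Fintype.card G) : ℂ))⁻¹ * ((Real.sqrt (Fintype.card G) : ℂ))⁻¹
      = (Fintype.card G : ℂ)⁻¹ := by
    rw [← mul_inv, ← Complex.ofReal_mul, Real.mul_self_sqrt (by positivity)]
    simp
  have key : inn (relKet h χ) (relKet j ψ) = (Fintype.card G : ℂ)⁻¹ *
      ∑ g : G, ∑ g' : G, star (χ.1 g⁻¹) * (ψ.1 g'⁻¹ * inn (ket (cfg h g)) (ket (cfg j g'))) := by
    simp only [inn, relKet, star_smul, star_sum, smul_dotProduct, dotProduct_smul,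
      sum_dotProduct, dotProduct_sum, smul_eq_mul, ← hsq, Finset.mul_sum]
    rw [Finset.sum_comm]
    simp [mul_assoc, mul_left_comm]
  rw [key]
  by_cases hj : h = j
  · subst hj
    simp only [inn_ket_ket, cfg_inj, star_apply_inv, true_and, mul_ite, mul_one, mul_zero,
      Finset.sum_ite_eq, Finset.mem_univ, if_true, sum_char_mul_char_inv]
    split_ifs <;> simp
  · simp [inn_ket_ket, cfg_inj, hj]

lemma PiNot1_eq_sum {k : ℕ} (h : Fin k → G) :
    PiNot1 h = ∑ χ ∈ nontrivialChars G, outer (relKet h χ) (relKet h χ) :=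
  finsum_mem_eq_finite_toFinset_sum _ (Set.toFinite {χ : Ghat G | χ ≠ 1})

/-- The matrix unit `|h;𝟙⟩⟨j;𝟙|`. -/
abbrev relUnit {k : ℕ} (h j : Fin k → G) : Op G (k + 1) :=
  outer (relKet h (1 : Ghat G)) (relKet j (1 : Ghat G))

lemma hsInner_relUnit_relUnit {k : ℕ} (h j p q : Fin k → G) :
    hsInner (relUnit h j) (relUnit p q) = if h = p ∧ j = q then 1 else 0 := by
  rw [hsInner_outer_outer, inn_relKet_relKet, inn_relKet_relKet]
  by_cases h1 : h = p <;> by_cases h2 : j = q <;> simp [h1, h2, eq_comm]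

lemma hsInner_relUnit_PiNot1 {k : ℕ} (h j p : Fin k → G) :
    hsInner (relUnit h j) (PiNot1 p) = 0 := by
  rw [PiNot1_eq_sum, hsInner_sum_right]
  refine Finset.sum_eq_zero fun χ hχ => ?_
  have : (1 : Ghat G) ≠ χ := fun H => one_notMem_nontrivialChars (H ▸ hχ)
  simp [hsInner_outer_outer, inn_relKet_relKet, this]

lemma hsInner_PiNot1_relUnit {k : ℕ} (h j p : Fin k → G) :
    hsInner (PiNot1 p) (relUnit h j) = 0 := by
  rw [PiNot1_eq_sum, hsInner_sum_left]
  refine Finset.sum_eq_zero fun χ hχ => ?_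
  have : χ ≠ (1 : Ghat G) := fun H => one_notMem_nontrivialChars (H ▸ hχ)
  simp [hsInner_outer_outer, inn_relKet_relKet, this]

lemma hsInner_PiNot1_PiNot1 {k : ℕ} (h j : Fin k → G) :
    hsInner (PiNot1 h) (PiNot1 j) =
      if h = j then ((nontrivialChars G).card : ℂ) else 0 := by
  classical
  simp only [PiNot1_eq_sum, hsInner_sum_left, hsInner_sum_right, hsInner_outer_outer,
    inn_relKet_relKet]
  by_cases hj : h = j
  · subst hj
    have : ∀ χ ψ : Ghat G, ((if χ = ψ then 1 else 0) * (if ψ = χ then 1 else 0) : ℂ)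
        = if χ = ψ then 1 else 0 := fun χ ψ => by
      by_cases H : χ = ψ <;> simp [H]
    simp [this]
  · simp [hj]

lemma relUnit_mem_Aphys {k : ℕ} (h j : Fin k → G) : relUnit h j ∈ Aphys G k := by
  simp only [Aphys, Set.mem_ofPred_eq, Piphys, relUnit, Finset.sum_mul, Finset.mul_sum,
    outer_mul_outer, smul_mul_assoc, inn_relKet_relKet]
  simp

variable (G) in
/-- The generators `|h;𝟙⟩⟨j;𝟙|` and `Π_{h;χ≠𝟙}` of `A_alg`. -/
def algGenerators (k : ℕ) : Set (Op G (k + 1)) :=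
  {X | ∃ h j : Fin k → G, X = relUnit h j} ∪ {X | ∃ h : Fin k → G, X = PiNot1 h}

/-- `A_alg` is the linear span of its generators. -/
lemma Aalg_eq_span (k : ℕ) :
    Aalg G k = (Submodule.span ℂ (algGenerators G k) : Set (Op G (k + 1))) := by
  apply Set.Subset.antisymm
  · rintro X ⟨B, hB, a, rfl⟩
    refine Submodule.add_mem _ ?_ (Submodule.sum_mem _ fun h _ =>
      Submodule.smul_mem _ _ (Submodule.subset_span (Or.inr ⟨h, rfl⟩)))
    have hBP : B = Piphys G k * B * Piphys G k := hB
    rw [hBP]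
    simp only [Piphys, Finset.sum_mul, Finset.mul_sum, outer_mul_mul_outer]
    exact Submodule.sum_mem _ fun h _ => Submodule.sum_mem _ fun j _ =>
      Submodule.smul_mem _ _ (Submodule.subset_span (Or.inl ⟨_, _, rfl⟩))
  · intro X hX
    induction hX using Submodule.span_induction with
    | mem X hX =>
      rcases hX with ⟨h, j, rfl⟩ | ⟨h, rfl⟩
      · exact ⟨_, relUnit_mem_Aphys h j, 0, by simp⟩
      · exact ⟨0, by simp [Aphys], Pi.single h 1, by simp [Pi.single_apply]⟩
    | zero => exact ⟨0, by simp [Aphys], 0, by simp⟩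
    | add X Y _ _ hX hY =>
      obtain ⟨B, hB, a, rfl⟩ := hX
      obtain ⟨C, hC, b, rfl⟩ := hY
      refine ⟨B + C, ?_, a + b, ?_⟩
      · simp only [Aphys, Set.mem_ofPred_eq] at hB hC ⊢
        rw [mul_add, add_mul, ← hB, ← hC]
      · simp only [Pi.add_apply, add_smul, Finset.sum_add_distrib]
        abel
    | smul r X _ hX =>
      obtain ⟨B, hB, a, rfl⟩ := hX
      refine ⟨r • B, ?_, r • a, ?_⟩
      · simp only [Aphys, Set.mem_ofPred_eq] at hB ⊢
        rw [mul_smul_comm, smul_mul_assoc, ← hB]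
      · simp [smul_add, Finset.smul_sum, smul_smul]

/-- The embedding maps `A_alg^{(N)}` into `A_alg^{(N+M)}`. -/
lemma map_mem_Aalg {n m : ℕ}
    {c : (Fin n → G) → G} {Φ : Op G (n + 1) →ₗ[ℂ] Op G (n + m + 1 + 1)}
    (hrel : ∀ h j : Fin n → G, Φ (relUnit h j) = ∑ gv : Fin (m + 1) → G,
      relUnit (relcat h (fun t => (c h)⁻¹ * gv t)) (relcat j (fun t => (c j)⁻¹ * gv t)))
    (hnot1 : ∀ h : Fin n → G, Φ (PiNot1 h) = ∑ gv : Fin (m + 1) → G, PiNot1 (relcat h gv))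
    {X : Op G (n + 1)} (hX : X ∈ Aalg G n) : Φ X ∈ Aalg G (n + m + 1) := by
  rw [Aalg_eq_span, SetLike.mem_coe] at hX ⊢
  have hle : Submodule.span ℂ (algGenerators G n) ≤
      (Submodule.span ℂ (algGenerators G (n + m + 1))).comap Φ := by
    rw [Submodule.span_le]
    rintro X (⟨h, j, rfl⟩ | ⟨h, rfl⟩)
    · rw [SetLike.mem_coe, Submodule.mem_comap, hrel]
      exact Submodule.sum_mem _ fun gv _ => Submodule.subset_span (Or.inl ⟨_, _, rfl⟩)
    · rw [SetLike.mem_coe, Submodule.mem_comap, hnot1]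
      exact Submodule.sum_mem _ fun gv _ => Submodule.subset_span (Or.inr ⟨_, rfl⟩)
  exact hle hX

/-- On `A_alg`, the embedding rescales the Hilbert–Schmidt inner product by `|G|^M`. -/
lemma hsInner_map_map {n m : ℕ}
    {c : (Fin n → G) → G} {Φ : Op G (n + 1) →ₗ[ℂ] Op G (n + m + 1 + 1)}
    (hrel : ∀ h j : Fin n → G, Φ (relUnit h j) = ∑ gv : Fin (m + 1) → G,
      relUnit (relcat h (fun t => (c h)⁻¹ * gv t)) (relcat j (fun t => (c j)⁻¹ * gv t)))
    (hnot1 : ∀ h : Fin n → G, Φ (PiNot1 h) = ∑ gv : Fin (m + 1) → G, PiNot1 (relcat h gv))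
    {A X : Op G (n + 1)} (hA : A ∈ Aalg G n) (hX : X ∈ Aalg G n) :
    hsInner (Φ A) (Φ X) = (Fintype.card (Fin (m + 1) → G) : ℂ) * hsInner A X := by
  rw [Aalg_eq_span, SetLike.mem_coe] at hA hX
  refine hsInner_map_map_of_mem_span Φ _ _ ?_ hA hX
  rintro _ (⟨h, j, rfl⟩ | ⟨h, rfl⟩) _ (⟨p, q, rfl⟩ | ⟨p, rfl⟩)
  · rw [hrel, hrel]
    simp only [hsInner_sum_left, hsInner_sum_right, hsInner_relUnit_relUnit, relcat_mul_inj]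
    by_cases h1 : h = p <;> by_cases h2 : j = q <;> simp [h1, h2]
  · rw [hrel, hnot1]
    simp [hsInner_sum_left, hsInner_sum_right, hsInner_relUnit_PiNot1]
  · rw [hrel, hnot1]
    simp [hsInner_sum_left, hsInner_sum_right, hsInner_PiNot1_relUnit]
  · rw [hnot1, hnot1]
    simp only [hsInner_sum_left, hsInner_sum_right, hsInner_PiNot1_PiNot1, relcat_inj]
    by_cases h1 : h = p <;> simp [h1]

end Characters

end Helpers

/-- Let `Φ^U = Φ̃^U ∘ Π_alg^{(N)}` be the extended embedding
associated with `U ∈ U_sym` (determined by `c`), and let `Trinv^U := (Φ^U)†` be its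
Hilbert–Schmidt adjoint. Then `Trinv^U` is trace-preserving, maps `A_alg^{(N+M)}`
onto `A_alg^{(N)}`, and has the explicit matrix elements
`⟨h;𝟙|Trinv^U(ρ)|j;𝟙⟩ = ∑_{g⃗} ⟨(h, c(h)⁻¹g⃗);𝟙|ρ|(j, c(j)⁻¹g⃗);𝟙⟩`. -/
theorem stmt16 (G : Type) [Fintype G] [DecidableEq G] [CommGroup G] (n m : ℕ)
    (U : Op G (n + 1)) (c : (Fin n → G) → G) (hU : U ∈ Usym G n)
    (hc : ∀ (h : Fin n → G) (g : G),
      U.mulVec (ket (cfg h g)) = (trans (c h)).mulVec (ket (cfg h g)))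
    (PN : Op G (n + 1) →ₗ[ℂ] Op G (n + 1)) (hPN : IsHSProj (Aalg G n) PN)
    (ΦU : Op G (n + 1) →ₗ[ℂ] Op G (n + m + 1 + 1))
    (hfact : ∀ ρ : Op G (n + 1), ΦU ρ = ΦU (PN ρ))
    (hrel : ∀ h j : Fin n → G,
      ΦU (outer (relKet h (1 : Ghat G)) (relKet j (1 : Ghat G))) =
        ∑ gv : Fin (m + 1) → G,
          outer (relKet (relcat h (fun t => (c h)⁻¹ * gv t)) (1 : Ghat G))
                (relKet (relcat j (fun t => (c j)⁻¹ * gv t)) (1 : Ghat G)))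
    (hnot1 : ∀ h : Fin n → G,
      ΦU (PiNot1 h) = ∑ gv : Fin (m + 1) → G, PiNot1 (relcat h gv))
    (hone : ΦU (1 : Op G (n + 1)) = 1)
    (TrinvU : Op G (n + m + 1 + 1) →ₗ[ℂ] Op G (n + 1))
    (hadj : ∀ (A : Op G (n + 1)) (ρ : Op G (n + m + 1 + 1)),
      hsInner (ΦU A) ρ = hsInner A (TrinvU ρ)) :
    (∀ ρ : Op G (n + m + 1 + 1), (TrinvU ρ).trace = ρ.trace) ∧
    ((fun ρ => TrinvU ρ) '' Aalg G (n + m + 1) = Aalg G n) ∧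
    (∀ (h j : Fin n → G) (ρ : Op G (n + m + 1 + 1)),
      melem (relKet h (1 : Ghat G)) (TrinvU ρ) (relKet j (1 : Ghat G)) =
        ∑ gv : Fin (m + 1) → G,
          melem (relKet (relcat h (fun t => (c h)⁻¹ * gv t)) (1 : Ghat G)) ρ
                (relKet (relcat j (fun t => (c j)⁻¹ * gv t)) (1 : Ghat G))) := by
  have hcard : (Fintype.card (Fin (m + 1) → G) : ℂ) ≠ 0 := by
    exact_mod_cast Fintype.card_ne_zero
  obtain ⟨hmem, hfix, hself⟩ := hPN
  refine ⟨fun ρ => ?_, Set.Subset.antisymm ?_ ?_, fun h j ρ => ?_⟩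
  · have H := hadj 1 ρ
    rw [hone] at H
    simpa [hsInner] using H.symm
  · rintro _ ⟨ρ, -, rfl⟩
    have : TrinvU ρ = PN (TrinvU ρ) := eq_of_hsInner_eq fun A => by
      rw [← hself, ← hadj, ← hadj, ← hfact]
    change TrinvU ρ ∈ Aalg G n
    rw [this]
    exact hmem _
  · intro X hX
    have hTr : TrinvU (ΦU X) = (Fintype.card (Fin (m + 1) → G) : ℂ) • X :=
      eq_of_hsInner_eq fun A => by
        rw [← hadj, hfact A, hsInner_map_map hrel hnot1 (hmem A) hX, hself, hfix X hX,
          hsInner_smul_right]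
    refine ⟨ΦU ((Fintype.card (Fin (m + 1) → G) : ℂ)⁻¹ • X),
      map_mem_Aalg hrel hnot1 ?_, ?_⟩
    · rw [Aalg_eq_span, SetLike.mem_coe] at hX ⊢
      exact Submodule.smul_mem _ _ hX
    · change TrinvU (ΦU _) = X
      rw [map_smul, map_smul, hTr, inv_smul_smul₀ hcard]
  · rw [← hsInner_outer_left, ← hadj, hrel, hsInner_sum_left]
    simp only [hsInner_outer_left]

end QRF

end
end

section
/- Let M ≥ 1. Then: (a) (Π_phys^{(N)} ⊗ 1_{H_M}) Π_phys^{(N+M)} = Π_phys^{(N)} ⊗ Π_phys^{(M)}; (b) for every A ∈ A_phys^{(N)}, Π_phys^{(N+M)} (A ⊗ 1_{H_M}) Π_phys^{(N+M)} = A ⊗ Π_phys^{(M)}; (c) the map Φ_phys : A_phys^{(N)} → A_phys^{(N+M)}, Φ_phys(A) := A ⊗ Π_phys^{(M)}, is well defined, ℂ-linear, multiplicative and adjoint-preserving; (d) if |G| ≥ 2, Φ_phys is not unital: Φ_phys(Π_phys^{(N)}) = Π_phys^{(N)} ⊗ Π_phys^{(M)} ≠ Π_phys^{(N+M)} (indeed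 tr(Π_phys^{(N)} ⊗ Π_phys^{(M)}) = |G|^{N+M−2} while tr(Π_phys^{(N+M)}) = |G|^{N+M−1}). -/
noncomputable section

open Matrix

namespace QRF

section PhysicalProjection

variable {G : Type}

/-- The identification `G^{N+M} ≃ G^N × G^M` underlying `tensorOp`. -/
def splitEquiv (n m : ℕ) :
    (Fin (n + m + 1 + 1) → G) ≃ (Fin (n + 1) → G) × (Fin (m + 1) → G) where
  toFun x := (split1 x, split2 x)
  invFun p := join p.1 p.2
  left_inv x := by
    funext i
    by_cases hi : i.1 < n + 1
    · simp [join, split1, hi]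
    · simp only [join, split2, hi, dite_false]
      congr 1
      ext
      simp only
      omega
  right_inv p := by
    refine Prod.ext ?_ ?_
    · funext i
      exact dif_pos i.2
    · funext i
      have hi : ¬ n + 1 + i.1 < n + 1 := by omega
      simp only [join, split2, hi, dite_false, Nat.add_sub_cancel_left]

variable {n m : ℕ}

theorem tensorOp_eq_submatrix (A : Op G (n + 1)) (B : Op G (m + 1)) :
    tensorOp A B =
      (Matrix.kronecker A B).submatrix (splitEquiv n m) (splitEquiv n m) :=
  rfl

theorem tensorOp_add_left (A A' : Op G (n + 1)) (B : Op G (m + 1)) :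
    tensorOp (A + A') B = tensorOp A B + tensorOp A' B := by
  ext x y
  simp [tensorOp, add_mul]

theorem tensorOp_smul_left (t : ℂ) (A : Op G (n + 1)) (B : Op G (m + 1)) :
    tensorOp (t • A) B = t • tensorOp A B := by
  ext x y
  simp [tensorOp, mul_assoc]

theorem tensorOp_smul_right (t : ℂ) (A : Op G (n + 1)) (B : Op G (m + 1)) :
    tensorOp A (t • B) = t • tensorOp A B := by
  ext x y
  simp [tensorOp, mul_left_comm]

theorem tensorOp_sum_right {ι : Type*} (s : Finset ι) (A : Op G (n + 1))
    (B : ι → Op G (m + 1)) :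
    tensorOp A (∑ i ∈ s, B i) = ∑ i ∈ s, tensorOp A (B i) := by
  ext x y
  simp [tensorOp, Matrix.sum_apply, Finset.mul_sum]

theorem conjTranspose_tensorOp (A : Op G (n + 1)) (B : Op G (m + 1)) :
    (tensorOp A B)ᴴ = tensorOp Aᴴ Bᴴ := by
  ext x y
  simp [tensorOp]

theorem tensorOp_mul_tensorOp [Fintype G] (A A' : Op G (n + 1)) (B B' : Op G (m + 1)) :
    tensorOp A B * tensorOp A' B' = tensorOp (A * A') (B * B') := by
  simp only [tensorOp_eq_submatrix, Matrix.submatrix_mul_equiv]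
  congr 1
  exact (Matrix.mul_kronecker_mul A A' B B').symm

theorem trace_tensorOp [Fintype G] (A : Op G (n + 1)) (B : Op G (m + 1)) :
    (tensorOp A B).trace = A.trace * B.trace := by
  rw [← Matrix.trace_kronecker, tensorOp_eq_submatrix]
  exact Fintype.sum_equiv (splitEquiv n m) _ _ fun _ => rfl

variable [CommGroup G]

/-- The relations `x_i x_0⁻¹` of a configuration. -/
def relations {k : ℕ} (x : Fin (k + 1) → G) : Fin k → G :=
  fun i => x i.succ * (x 0)⁻¹

theorem eq_cfg_iff {k : ℕ} (x : Fin (k + 1) → G) (h : Fin k → G) (g : G) :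
    x = cfg h g ↔ x 0 = g ∧ relations x = h := by
  constructor
  · rintro rfl
    exact ⟨rfl, funext fun i => by simp [relations, cfg]⟩
  · rintro ⟨rfl, rfl⟩
    funext i
    refine Fin.cases ?_ (fun i => ?_) i <;> simp [relations, cfg]

theorem eq_translate_iff {k : ℕ} (x y : Fin (k + 1) → G) (g : G) :
    x = (fun i => g * y i) ↔ x 0 * (y 0)⁻¹ = g ∧ relations x = relations y := by
  constructor
  · rintro rfl
    exact ⟨by simp, funext fun i => by
      rw [relations, relations, mul_inv, mul_mul_mul_comm, mul_inv_cancel, one_mul]⟩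
  · rintro ⟨rfl, hrel⟩
    funext i
    refine Fin.cases (by simp) (fun i => ?_) i
    have hi : x i.succ * (x 0)⁻¹ = y i.succ * (y 0)⁻¹ := congrFun hrel i
    rw [mul_assoc, mul_comm (y 0)⁻¹, ← hi, mul_comm, inv_mul_cancel_right]

variable [DecidableEq G]

theorem conjTranspose_trans {K : ℕ} (g : G) : (trans g : Op G K)ᴴ = trans g⁻¹ := by
  ext x y
  have key : y = (fun i => g * x i) ↔ x = (fun i => g⁻¹ * y i) := by
    simp only [funext_iff, eq_inv_mul_iff_mul_eq, eq_comm]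
  simp [trans, key, apply_ite]

theorem tensorOp_trans_trans (g : G) :
    tensorOp (trans g : Op G (n + 1)) (trans g : Op G (m + 1)) = trans g := by
  ext x y
  have key : x = (fun i => g * y i) ↔
      split1 x = (fun i => g * split1 y i) ∧ split2 x = (fun i => g * split2 y i) := by
    rw [← (splitEquiv n m).injective.eq_iff, Prod.ext_iff]
    rfl
  simp only [tensorOp, trans, Matrix.of_apply, key, ite_and]
  split_ifs <;> simp

variable [Fintype G]

theorem trans_mul_trans {K : ℕ} (g h : G) :
    (trans g : Op G K) * trans h = trans (g * h) := by
  ext x y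
  simp [Matrix.mul_apply, trans, mul_assoc]

theorem trace_trans {k : ℕ} (g : G) :
    (trans g : Op G (k + 1)).trace = if g = 1 then (Fintype.card G : ℂ) ^ (k + 1) else 0 := by
  have key : ∀ x : Fin (k + 1) → G, x = (fun i => g * x i) ↔ g = 1 := by
    intro x
    simp [funext_iff]
  simp only [Matrix.trace, Matrix.diag, trans, Matrix.of_apply, key]
  split_ifs <;> simp

theorem relKet_one_apply {k : ℕ} (h : Fin k → G) (x : Fin (k + 1) → G) :
    relKet h (1 : Ghat G) x =
      if relations x = h then ((Real.sqrt (Fintype.card G) : ℂ))⁻¹ else 0 := by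
  have hone : ∀ g : G, (1 : Ghat G).1 g = 1 := fun _ => rfl
  simp [relKet, hone, ket, eq_cfg_iff, Finset.sum_apply, ite_and]

theorem Piphys_eq_sum_trans (k : ℕ) :
    Piphys G k = (Fintype.card G : ℂ)⁻¹ • ∑ g : G, trans g := by
  have hsq : ((Real.sqrt (Fintype.card G) : ℂ))⁻¹ * ((Real.sqrt (Fintype.card G) : ℂ))⁻¹ =
      (Fintype.card G : ℂ)⁻¹ := by
    rw [← mul_inv, ← Complex.ofReal_mul, Real.mul_self_sqrt (Nat.cast_nonneg _),
      Complex.ofReal_natCast]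
  ext x y
  simp [Piphys, Matrix.sum_apply, outer, relKet_one_apply, trans, eq_translate_iff, ite_and,
    apply_ite, hsq, eq_comm]

theorem trans_mul_Piphys {k : ℕ} (g : G) : trans g * Piphys G k = Piphys G k := by
  rw [Piphys_eq_sum_trans, Matrix.mul_smul, Matrix.mul_sum]
  congr 1
  simp only [trans_mul_trans]
  exact Equiv.sum_comp (Equiv.mulLeft g) (fun h => (trans h : Op G (k + 1)))

theorem Piphys_mul_trans {k : ℕ} (g : G) : Piphys G k * trans g = Piphys G k := by
  rw [Piphys_eq_sum_trans, Matrix.smul_mul, Matrix.sum_mul]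
  congr 1
  simp only [trans_mul_trans]
  exact Equiv.sum_comp (Equiv.mulRight g) (fun h => (trans h : Op G (k + 1)))

theorem Piphys_mul_self (k : ℕ) : Piphys G k * Piphys G k = Piphys G k := by
  conv_lhs => lhs; rw [Piphys_eq_sum_trans]
  simp [Matrix.sum_mul, trans_mul_Piphys, ← Nat.cast_smul_eq_nsmul ℂ, smul_smul]

theorem conjTranspose_Piphys (k : ℕ) : (Piphys G k)ᴴ = Piphys G k := by
  simp only [Piphys_eq_sum_trans, Matrix.conjTranspose_smul, Matrix.conjTranspose_sum,
    conjTranspose_trans]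
  congr 1
  · simp
  · exact Equiv.sum_comp (Equiv.inv G) (fun h => (trans h : Op G (k + 1)))

theorem trace_Piphys (k : ℕ) : (Piphys G k).trace = (Fintype.card G : ℂ) ^ k := by
  simp [Piphys_eq_sum_trans, Matrix.trace_sum, trace_trans, pow_succ']

theorem trans_mul_of_mem_Aphys {k : ℕ} {A : Op G (k + 1)} (hA : A ∈ Aphys G k) (g : G) :
    trans g * A = A := by
  rw [show A = Piphys G k * A * Piphys G k from hA, ← Matrix.mul_assoc, ← Matrix.mul_assoc,
    trans_mul_Piphys]

theorem mul_trans_of_mem_Aphys {k : ℕ} {A : Op G (k + 1)} (hA : A ∈ Aphys G k) (g : G) :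
    A * trans g = A := by
  rw [show A = Piphys G k * A * Piphys G k from hA, Matrix.mul_assoc, Piphys_mul_trans]

theorem Piphys_mem_Aphys (k : ℕ) : Piphys G k ∈ Aphys G k := by
  simp [Aphys, Piphys_mul_self]

theorem Piphys_eq_sum_tensorOp (n m : ℕ) :
    Piphys G (n + m + 1) = (Fintype.card G : ℂ)⁻¹ •
      ∑ g : G, tensorOp (trans g : Op G (n + 1)) (trans g : Op G (m + 1)) := by
  simp only [Piphys_eq_sum_trans, tensorOp_trans_trans]

theorem tensorOp_mul_Piphys {A : Op G (n + 1)} (hA : A ∈ Aphys G n) (B : Op G (m + 1)) :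
    tensorOp A B * Piphys G (n + m + 1) = tensorOp A (B * Piphys G m) := by
  rw [Piphys_eq_sum_tensorOp, Piphys_eq_sum_trans m]
  simp only [Matrix.mul_smul, Matrix.mul_sum, tensorOp_mul_tensorOp,
    mul_trans_of_mem_Aphys hA, tensorOp_smul_right, tensorOp_sum_right]

theorem Piphys_mul_tensorOp {A : Op G (n + 1)} (hA : A ∈ Aphys G n) (B : Op G (m + 1)) :
    Piphys G (n + m + 1) * tensorOp A B = tensorOp A (Piphys G m * B) := by
  rw [Piphys_eq_sum_tensorOp, Piphys_eq_sum_trans m]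
  simp only [Matrix.smul_mul, Matrix.sum_mul, tensorOp_mul_tensorOp,
    trans_mul_of_mem_Aphys hA, tensorOp_smul_right, tensorOp_sum_right]

end PhysicalProjection

/-- (a) `(Π_phys^{(N)} ⊗ 1) Π_phys^{(N+M)} = Π_phys^{(N)} ⊗ Π_phys^{(M)}`;
(b) for `A ∈ A_phys^{(N)}`, `Π_phys^{(N+M)} (A ⊗ 1) Π_phys^{(N+M)} = A ⊗ Π_phys^{(M)}`;
(c) `Φ_phys(A) := A ⊗ Π_phys^{(M)}` is a well-defined linear, multiplicative,
adjoint-preserving embedding of `A_phys^{(N)}` into `A_phys^{(N+M)}`;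
(d) if `|G| ≥ 2` it is not unital, with the stated traces. -/
theorem stmt17 (G : Type) [Fintype G] [DecidableEq G] [CommGroup G] (n m : ℕ) :
    (tensorOp (Piphys G n) (1 : Op G (m + 1)) * Piphys G (n + m + 1) =
      tensorOp (Piphys G n) (Piphys G m)) ∧
    (∀ A ∈ Aphys G n,
      Piphys G (n + m + 1) * tensorOp A (1 : Op G (m + 1)) * Piphys G (n + m + 1) =
        tensorOp A (Piphys G m)) ∧
    (∀ A ∈ Aphys G n, tensorOp A (Piphys G m) ∈ Aphys G (n + m + 1)) ∧
    (∀ A ∈ Aphys G n, ∀ B ∈ Aphys G n,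
      tensorOp (A + B) (Piphys G m) =
        tensorOp A (Piphys G m) + tensorOp B (Piphys G m)) ∧
    (∀ (t : ℂ), ∀ A ∈ Aphys G n,
      tensorOp (t • A) (Piphys G m) = t • tensorOp A (Piphys G m)) ∧
    (∀ A ∈ Aphys G n, ∀ B ∈ Aphys G n,
      tensorOp (A * B) (Piphys G m) =
        tensorOp A (Piphys G m) * tensorOp B (Piphys G m)) ∧
    (∀ A ∈ Aphys G n, tensorOp Aᴴ (Piphys G m) = (tensorOp A (Piphys G m))ᴴ) ∧
    (2 ≤ Fintype.card G →
      tensorOp (Piphys G n) (Piphys G m) ≠ Piphys G (n + m + 1) ∧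
      (tensorOp (Piphys G n) (Piphys G m)).trace = (Fintype.card G : ℂ) ^ (n + m) ∧
      (Piphys G (n + m + 1)).trace = (Fintype.card G : ℂ) ^ (n + m + 1)) := by
  have htensor : (tensorOp (Piphys G n) (Piphys G m)).trace = (Fintype.card G : ℂ) ^ (n + m) := by
    rw [trace_tensorOp, trace_Piphys, trace_Piphys, pow_add]
  refine ⟨?_, ?_, ?_, ?_, ?_, ?_, ?_, ?_⟩
  · rw [tensorOp_mul_Piphys (Piphys_mem_Aphys n), one_mul]
  · intro A hA
    rw [Piphys_mul_tensorOp hA, tensorOp_mul_Piphys hA, mul_one, Piphys_mul_self]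
  · intro A hA
    change _ = _
    rw [Piphys_mul_tensorOp hA, tensorOp_mul_Piphys hA, Piphys_mul_self, Piphys_mul_self]
  · exact fun A _ B _ => tensorOp_add_left A B _
  · exact fun t A _ => tensorOp_smul_left t A _
  · intro A _ B _
    rw [tensorOp_mul_tensorOp, Piphys_mul_self]
  · intro A _
    rw [conjTranspose_tensorOp, conjTranspose_Piphys]
  · intro hcard
    refine ⟨fun heq => ?_, htensor, trace_Piphys _⟩
    rw [heq, trace_Piphys] at htensor
    have hpow : Fintype.card G ^ (n + m + 1) = Fintype.card G ^ (n + m) := by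
      exact_mod_cast htensor
    exact (Nat.pow_lt_pow_right hcard (Nat.lt_succ_self (n + m))).ne' hpow

end QRF

end
end
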